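/- arXiv:1601.03911 — 2 statements merged into one kernel-verified Lean document; each statement's English description precedes it below -/
import Mathlib

section
/- Assume either 1 < α < 2 with 1 < βᵢ < 1/(α−1) for i = 1,2 and 1/β₁ + 1/β₂ < α, or 0 < α ≤ 1 with βᵢ > 1/α for i = 1,2 and 1/β₁ + 1/β₂ < α. Let (m_n) be a sequence of positive integers such that m_n^{−β₂}/n^{−β₁} → 0 as n → ∞. Then lim_{n→∞} ρ(n,−m_n)/(n^{−β₁/β₂} m_n^{1−β₂α}) = Σ_{i=0}^∞ ∫₀^∞ V(v^{−β₂}, w_{(i,∞)} (1+i)^{−β₁}) dv. -/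
open Filter MeasureTheory Real Set

/-- The kernel `V(x,y) = xy/(x^2+y^2)^{(2-α)/2}` with `V(0,0)=0`. -/
noncomputable def V (α : ℝ) : ℝ → ℝ → ℝ := fun x y =>
  if x = 0 ∧ y = 0 then 0 else x * y / (x ^ 2 + y ^ 2) ^ ((2 - α) / 2)

lemma V_abs_le (α p x y : ℝ) (h1 : α - 1 ≤ p) (h2 : p ≤ 1) :
    |V α x y| ≤ |x| ^ p * |y| ^ (α - p) := by
  unfold V
  split_ifs with h
  · simp only [abs_zero]; positivity
  by_cases hx : x = 0
  · subst hx; simp only [zero_mul, zero_div, abs_zero]; positivity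
  by_cases hy : y = 0
  · subst hy; simp only [mul_zero, zero_div, abs_zero]; positivity
  have ha : 0 < |x| := abs_pos.mpr hx
  have hb : 0 < |y| := abs_pos.mpr hy
  have hs : 0 < x ^ 2 + y ^ 2 := by positivity
  have hD : 0 < (x ^ 2 + y ^ 2) ^ ((2 - α) / 2) := by positivity
  rw [abs_div, abs_mul, abs_of_pos hD, div_le_iff₀ hD]
  set r := √(x ^ 2 + y ^ 2) with hr
  have hr0 : 0 < r := Real.sqrt_pos.mpr hs
  have hxr : |x| ≤ r := Real.abs_le_sqrt (by nlinarith [sq_nonneg y])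
  have hyr : |y| ≤ r := Real.abs_le_sqrt (by nlinarith [sq_nonneg x])
  have hDr : (x ^ 2 + y ^ 2) ^ ((2 - α) / 2) = r ^ (1 - p) * r ^ (1 - α + p) := by
    rw [← Real.rpow_add hr0, hr, Real.sqrt_eq_rpow, ← Real.rpow_mul hs.le]
    congr 1; ring
  have e1 : |x| = |x| ^ p * |x| ^ (1 - p) := by
    rw [← Real.rpow_add ha]; simp
  have e2 : |y| = |y| ^ (α - p) * |y| ^ (1 - α + p) := by
    rw [← Real.rpow_add hb]
    rw [show α - p + (1 - α + p) = 1 by ring, Real.rpow_one]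
  have i1 : |x| ^ (1 - p) ≤ r ^ (1 - p) := Real.rpow_le_rpow ha.le hxr (by linarith)
  have i2 : |y| ^ (1 - α + p) ≤ r ^ (1 - α + p) := Real.rpow_le_rpow hb.le hyr (by linarith)
  calc |x| * |y| = (|x| ^ p * |y| ^ (α - p)) * (|x| ^ (1 - p) * |y| ^ (1 - α + p)) := by
        conv_lhs => rw [e1, e2]
        ring
    _ ≤ (|x| ^ p * |y| ^ (α - p)) * (r ^ (1 - p) * r ^ (1 - α + p)) := by gcongr
    _ = _ := by rw [hDr]

lemma V_smul (α l x y : ℝ) (hl : 0 < l) : V α (l * x) (l * y) = l ^ α * V α x y := by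
  unfold V
  by_cases h : x = 0 ∧ y = 0
  · simp [h]
  · have h' : ¬ (l * x = 0 ∧ l * y = 0) := by simpa [hl.ne'] using h
    rw [if_neg h, if_neg h']
    have hs : 0 ≤ x ^ 2 + y ^ 2 := by positivity
    rw [show (l * x) ^ 2 + (l * y) ^ 2 = l ^ 2 * (x ^ 2 + y ^ 2) by ring,
      Real.mul_rpow (by positivity) hs]
    have : l * x * (l * y) = l ^ (2:ℝ) * (x * y) := by
      rw [Real.rpow_two]; ring
    have e : l ^ α = l ^ (2:ℝ) / (l ^ 2) ^ ((2 - α) / 2) := by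
      rw [← Real.rpow_two, ← Real.rpow_mul hl.le, ← Real.rpow_sub hl]
      congr 1; ring
    rw [this, e, mul_div_mul_comm]

lemma V_tendsto (α : ℝ) (x y : ℕ → ℝ) (a b : ℝ) (ha : 0 < a)
    (hx : Tendsto x atTop (nhds a)) (hy : Tendsto y atTop (nhds b)) :
    Tendsto (fun n => V α (x n) (y n)) atTop (nhds (V α a b)) := by
  have hs : 0 < a ^ 2 + b ^ 2 := by positivity
  have h1 : V α a b = a * b / (a ^ 2 + b ^ 2) ^ ((2 - α) / 2) := by
    unfold V; rw [if_neg]; intro h; exact ha.ne' h.1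
  rw [h1]
  have : Tendsto (fun n => x n * y n / ((x n) ^ 2 + (y n) ^ 2) ^ ((2 - α) / 2)) atTop
      (nhds (a * b / (a ^ 2 + b ^ 2) ^ ((2 - α) / 2))) := by
    refine (hx.mul hy).div ?_ (by positivity)
    exact ((hx.pow 2).add (hy.pow 2)).rpow_const (Or.inl hs.ne')
  refine this.congr' ?_
  filter_upwards [hx.eventually (lt_mem_nhds ha)] with n hn
  unfold V; rw [if_neg]; intro h; exact hn.ne' h.1

lemma w_bdd (w : ℕ → ℕ → ℝ)
    (hA1 : Tendsto (fun p : ℕ × ℕ => w p.1 p.2) (atTop ×ˢ atTop) (nhds 1))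
    (winf : ℕ → ℝ) (hA2 : ∀ i, Tendsto (fun j => w i j) atTop (nhds (winf i)))
    (wco : ℕ → ℝ) (hA3 : ∀ j, Tendsto (fun i => w i j) atTop (nhds (wco j))) :
    ∃ W : ℝ, 0 < W ∧ ∀ i j, |w i j| ≤ W := by
  have hR : ∀ i, ∃ R, ∀ j, |w i j| ≤ R := fun i => by
    obtain ⟨R, hR⟩ := (hA2 i).abs.bddAbove_range
    exact ⟨R, fun j => hR ⟨j, rfl⟩⟩
  have hC : ∀ j, ∃ R, ∀ i, |w i j| ≤ R := fun j => by
    obtain ⟨R, hR⟩ := (hA3 j).abs.bddAbove_range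
    exact ⟨R, fun i => hR ⟨i, rfl⟩⟩
  choose R hR using hR
  choose C hC using hC
  have hev : ∀ᶠ p : ℕ × ℕ in atTop, |w p.1 p.2| < 2 := by
    rw [← prod_atTop_atTop_eq]
    have := hA1.abs
    rw [abs_one] at this
    exact this.eventually (gt_mem_nhds (by norm_num))
  obtain ⟨⟨N, M⟩, hN⟩ := eventually_atTop.mp hev
  have R0 : ∀ i, 0 ≤ R i := fun i => (abs_nonneg _).trans (hR i 0)
  have C0 : ∀ i, 0 ≤ C i := fun i => (abs_nonneg _).trans (hC i 0)
  have SR : 0 ≤ ∑ i ∈ Finset.range N, R i := Finset.sum_nonneg fun i _ => R0 i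
  have SC : 0 ≤ ∑ i ∈ Finset.range M, C i := Finset.sum_nonneg fun i _ => C0 i
  refine ⟨2 + ∑ i ∈ Finset.range N, R i + ∑ i ∈ Finset.range M, C i, by positivity, ?_⟩
  intro i j
  by_cases hi : i < N
  · have := Finset.single_le_sum (fun i _ => R0 i) (Finset.mem_range.mpr hi)
    linarith [hR i j]
  by_cases hj : j < M
  · have := Finset.single_le_sum (fun i _ => C0 i) (Finset.mem_range.mpr hj)
    linarith [hC j i]
  · have := hN (i, j) ⟨not_lt.mp hi, not_lt.mp hj⟩
    simp only at this
    linarith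

lemma tsum_eq_integral_floor (f : ℕ → ℝ) (s : ℝ) (hs : 0 < s)
    (hf : IntegrableOn (fun v : ℝ => f ⌊s * v⌋₊) (Ioi 0)) :
    ∑' j, f j = s * ∫ v in Ioi (0:ℝ), f ⌊s * v⌋₊ := by
  have h1 : IntegrableOn (fun v : ℝ => f ⌊v⌋₊) (Ioi 0) := by
    have := (integrableOn_Ioi_comp_mul_left_iff (fun v : ℝ => f ⌊v⌋₊) 0 hs).mp hf
    simpa using this
  have h2 := integral_comp_mul_left_Ioi (fun v : ℝ => f ⌊v⌋₊) 0 hs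
  simp only [mul_zero, smul_eq_mul] at h2
  rw [h2, ← mul_assoc, mul_inv_cancel₀ hs.ne', one_mul]
  have hU : (⋃ j : ℕ, Ico (j:ℝ) (j+1)) = Ici 0 := by
    ext x
    simp only [mem_iUnion, mem_Ico, mem_Ici]
    constructor
    · rintro ⟨j, hj, _⟩; exact (Nat.cast_nonneg j).trans hj
    · intro hx; exact ⟨⌊x⌋₊, Nat.floor_le hx, Nat.lt_floor_add_one x⟩
  have hd : Pairwise (Function.onFun Disjoint fun j : ℕ => Ico (j:ℝ) (j+1)) := by
    intro a b hab
    rw [Function.onFun, Set.disjoint_left]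
    rintro x ⟨h1, h2⟩ ⟨h3, h4⟩
    apply hab
    have e1 : a < b + 1 := by exact_mod_cast h1.trans_lt h4
    have e2 : b < a + 1 := by exact_mod_cast h3.trans_lt h2
    omega
  rw [← integral_Ici_eq_integral_Ioi, ← hU, integral_iUnion (fun _ => measurableSet_Ico) hd
    (by rw [hU]; rw [integrableOn_Ici_iff_integrableOn_Ioi]; exact h1)]
  congr 1; ext j
  have : ∫ v in Ico (j:ℝ) (j+1), f ⌊v⌋₊ = ∫ v in Ico (j:ℝ) (j+1), f j := by
    refine setIntegral_congr_fun measurableSet_Ico ?_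
    intro v hv
    have : ⌊v⌋₊ = j := Nat.floor_eq_on_Ico j v hv
    simp only [this]
  rw [this]; simp

lemma g_integrable (a b : ℝ) (ha : a < 1) (hb : 1 < b) :
    IntegrableOn (fun v : ℝ => if v ≤ 1 then v ^ (-a) else v ^ (-b)) (Ioi 0) := by
  rw [← Ioc_union_Ioi_eq_Ioi (zero_le_one' ℝ)]
  refine IntegrableOn.union ?_ ?_
  · have : IntegrableOn (fun v : ℝ => v ^ (-a)) (Ioc 0 1) := by
      have := intervalIntegral.intervalIntegrable_rpow' (a := 0) (b := 1) (r := -a) (by linarith)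
      rwa [intervalIntegrable_iff_integrableOn_Ioc_of_le zero_le_one] at this
    refine this.congr_fun ?_ measurableSet_Ioc
    intro v hv; simp only [if_pos hv.2]
  · have : IntegrableOn (fun v : ℝ => v ^ (-b)) (Ioi 1) :=
      integrableOn_Ioi_rpow_of_lt (by linarith) one_pos
    refine this.congr_fun ?_ measurableSet_Ioi
    intro v hv; simp only [if_neg (not_le.mpr (mem_Ioi.mp hv))]

lemma main_aux (α β₁ β₂ p₁ p₂ : ℝ) (hβ₁ : 0 < β₁) (hβ₂ : 0 < β₂)
    (ha1 : α - 1 ≤ p₁) (h01 : 0 ≤ p₁) (hp1 : p₁ < 1 / β₂) (hp2 : 1 / β₂ < p₂) (hp2' : p₂ ≤ 1)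
    (hp2a : p₂ < α - 1 / β₁)
    (w : ℕ → ℕ → ℝ)
    (hA1 : Tendsto (fun p : ℕ × ℕ => w p.1 p.2) (atTop ×ˢ atTop) (nhds 1))
    (winf : ℕ → ℝ)
    (hA2 : ∀ i, Tendsto (fun j => w i j) atTop (nhds (winf i)))
    (W : ℝ) (hW0 : 0 < W) (hW : ∀ i j, |w i j| ≤ W)
    (c : ℕ → ℕ → ℝ)
    (hc : ∀ i j, c i j = w i j * (1 + (i : ℝ)) ^ (-β₁) * (1 + (j : ℝ)) ^ (-β₂))
    (ρ : ℕ → ℕ → ℝ)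
    (hρ : ∀ n m : ℕ, 1 ≤ n → 1 ≤ m →
      ρ n m = ∑' i : ℕ, ∑' j : ℕ, V α (c (i + n) j) (c i (j + m)))
    (m : ℕ → ℕ) (hm : ∀ n, 1 ≤ m n)
    (hratio : Tendsto (fun n : ℕ => (m n : ℝ) ^ (-β₂) / (n : ℝ) ^ (-β₁))
      atTop (nhds 0)) :
    Tendsto (fun n : ℕ => ρ n (m n) / ((n : ℝ) ^ (-(β₁ / β₂)) * (m n : ℝ) ^ (1 - β₂ * α)))
      atTop
      (nhds (∑' i : ℕ, ∫ v in Ioi (0 : ℝ), V α (v ^ (-β₂)) (winf i * (1 + (i : ℝ)) ^ (-β₁)))) := by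
  have hm0 : ∀ n, (0:ℝ) < m n := fun n => by exact_mod_cast hm n
  have hβi : 0 < 1 / β₁ := by positivity
  set s : ℕ → ℝ := fun n => (m n : ℝ) * (n : ℝ) ^ (-(β₁ / β₂)) with hs
  have hs0 : ∀ n, 1 ≤ n → 0 < s n := fun n hn => by
    have : (0:ℝ) < n := by exact_mod_cast hn
    have := hm0 n
    simp only [hs]; positivity
  have hspow : ∀ n, 1 ≤ n → (s n) ^ (-β₂) = (m n : ℝ) ^ (-β₂) / (n : ℝ) ^ (-β₁) := fun n hn => by
    have h0 : (0:ℝ) < n := by exact_mod_cast hn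
    simp only [hs]
    rw [Real.mul_rpow (hm0 n).le (by positivity), ← Real.rpow_mul h0.le,
      Real.rpow_neg h0.le β₁, div_inv_eq_mul]
    congr 2; field_simp
  have hs_lim : Tendsto s atTop atTop := by
    have h1 : Tendsto (fun n => (s n) ^ (-β₂)) atTop (nhds 0) := by
      refine hratio.congr' ?_
      filter_upwards [eventually_ge_atTop 1] with n hn
      rw [hspow n hn]
    have h2 : Tendsto (fun n => (s n) ^ (-β₂)) atTop (nhdsWithin 0 (Ioi 0)) := by
      rw [tendsto_nhdsWithin_iff]
      refine ⟨h1, ?_⟩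
      filter_upwards [eventually_ge_atTop 1] with n hn
      exact Real.rpow_pos_of_pos (hs0 n hn) _
    have h3 := (tendsto_rpow_atTop (inv_pos.mpr hβ₂)).comp (tendsto_inv_nhdsGT_zero.comp h2)
    refine h3.congr' ?_
    filter_upwards [eventually_ge_atTop 1] with n hn
    have := (hs0 n hn).le
    simp only [Function.comp]
    rw [← Real.rpow_neg this, neg_neg, ← Real.rpow_mul this, mul_inv_cancel₀ hβ₂.ne', Real.rpow_one]
  have hsm : Tendsto (fun n => s n / m n) atTop (nhds 0) := by
    have h := (tendsto_rpow_neg_atTop (y := β₁ / β₂) (by positivity)).comp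
      (tendsto_natCast_atTop_atTop (R := ℝ))
    refine h.congr ?_
    intro n
    simp only [hs, Function.comp]
    rw [mul_div_cancel_left₀ _ (hm0 n).ne']
  have hmtop : Tendsto m atTop atTop := by
    rw [← tendsto_natCast_atTop_iff (R := ℝ)]
    refine tendsto_atTop_mono' _ ?_ hs_lim
    filter_upwards [hsm.eventually (gt_mem_nhds zero_lt_one)] with n hn
    rw [div_lt_one (hm0 n)] at hn
    exact hn.le
  -- the rescaled summand
  let F : ℕ → ℕ → ℝ → ℝ := fun n i v =>
    V α ((m n : ℝ) ^ β₂ * c (i + n) ⌊s n * v⌋₊) ((m n : ℝ) ^ β₂ * c i (⌊s n * v⌋₊ + m n))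
  let g : ℝ → ℝ := fun v => if v ≤ 1 then v ^ (-(β₂ * p₁)) else v ^ (-(β₂ * p₂))
  have hg : IntegrableOn g (Ioi 0) := by
    apply g_integrable
    · rw [lt_div_iff₀ hβ₂] at hp1; linarith
    · rw [div_lt_iff₀ hβ₂] at hp2; linarith
  have hxb : ∀ n, 1 ≤ n → ∀ i, ∀ v, 0 < v →
      |(m n : ℝ) ^ β₂ * c (i + n) ⌊s n * v⌋₊| ≤ W * v ^ (-β₂) := by
    intro n hn i v hv
    have h0 : (0:ℝ) < n := by exact_mod_cast hn
    have hmm := hm0 n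
    have hss := hs0 n hn
    have a1 : (1 + ((i + n : ℕ) : ℝ)) ^ (-β₁) ≤ (n : ℝ) ^ (-β₁) := by
      apply Real.rpow_le_rpow_of_nonpos h0 _ (by linarith)
      push_cast
      have : (0:ℝ) ≤ i := Nat.cast_nonneg i
      linarith
    have a2 : (1 + (⌊s n * v⌋₊ : ℝ)) ^ (-β₂) ≤ (s n * v) ^ (-β₂) := by
      apply Real.rpow_le_rpow_of_nonpos (by positivity) _ (by linarith)
      linarith [Nat.lt_floor_add_one (s n * v)]
    have a3 : (m n : ℝ) ^ β₂ * ((n : ℝ) ^ (-β₁) * (s n * v) ^ (-β₂)) = v ^ (-β₂) := by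
      rw [Real.mul_rpow hss.le hv.le, hspow n hn, Real.rpow_neg hmm.le]
      have : (0:ℝ) < (m n : ℝ) ^ β₂ := by positivity
      have : (0:ℝ) < (n : ℝ) ^ (-β₁) := by positivity
      field_simp
    rw [hc, abs_mul, abs_mul, abs_mul, abs_of_pos (show (0:ℝ) < (m n : ℝ) ^ β₂ by positivity),
      abs_of_pos (show (0:ℝ) < (1 + ((i + n : ℕ) : ℝ)) ^ (-β₁) by positivity),
      abs_of_pos (show (0:ℝ) < (1 + (⌊s n * v⌋₊ : ℝ)) ^ (-β₂) by positivity)]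
    calc _ ≤ (m n : ℝ) ^ β₂ * (W * (n : ℝ) ^ (-β₁) * (s n * v) ^ (-β₂)) := by
          gcongr; exact hW _ _
      _ = W * ((m n : ℝ) ^ β₂ * ((n : ℝ) ^ (-β₁) * (s n * v) ^ (-β₂))) := by ring
      _ = _ := by rw [a3]
  have hyb : ∀ n, ∀ i k : ℕ,
      |(m n : ℝ) ^ β₂ * c i (k + m n)| ≤ W * (1 + (i:ℝ)) ^ (-β₁) := by
    intro n i k
    have hmm := hm0 n
    have a2 : (1 + ((k + m n : ℕ) : ℝ)) ^ (-β₂) ≤ (m n : ℝ) ^ (-β₂) := by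
      apply Real.rpow_le_rpow_of_nonpos (by positivity) _ (by linarith)
      push_cast
      have : (0:ℝ) ≤ k := Nat.cast_nonneg k
      linarith
    have a3 : (m n : ℝ) ^ β₂ * (m n : ℝ) ^ (-β₂) = 1 := by
      rw [← Real.rpow_add hmm]; simp
    rw [hc, abs_mul, abs_mul, abs_mul, abs_of_pos (show (0:ℝ) < (m n : ℝ) ^ β₂ by positivity),
      abs_of_pos (show (0:ℝ) < (1 + (i : ℝ)) ^ (-β₁) by positivity),
      abs_of_pos (show (0:ℝ) < (1 + ((k + m n : ℕ) : ℝ)) ^ (-β₂) by positivity)]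
    calc _ ≤ (m n : ℝ) ^ β₂ * (W * (1 + (i : ℝ)) ^ (-β₁) * (m n : ℝ) ^ (-β₂)) := by
          gcongr; exact hW _ _
      _ = W * (1 + (i : ℝ)) ^ (-β₁) * ((m n : ℝ) ^ β₂ * (m n : ℝ) ^ (-β₂)) := by ring
      _ = _ := by rw [a3, mul_one]
  let b : ℕ → ℝ := fun i => W ^ α * (1 + (i:ℝ)) ^ (-(β₁ * (α - p₂)))
  have hb0 : ∀ i, 0 ≤ b i := fun i => by simp only [b]; positivity
  have hFp : ∀ p, p₁ ≤ p → p ≤ p₂ → ∀ n, 1 ≤ n → ∀ i, ∀ v, 0 < v →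
      |F n i v| ≤ b i * v ^ (-(β₂ * p)) := by
    intro p hpl hpu n hn i v hv
    refine (V_abs_le α p _ _ (by linarith) (by linarith)).trans ?_
    have hi1 : (1:ℝ) ≤ 1 + i := by
      have : (0:ℝ) ≤ i := Nat.cast_nonneg i
      linarith
    have hi0 : (0:ℝ) ≤ 1 + i := by linarith
    calc _ ≤ (W * v ^ (-β₂)) ^ p * (W * (1 + (i:ℝ)) ^ (-β₁)) ^ (α - p) := by
          have h1 : (0:ℝ) ≤ p := by linarith
          have h2 : (0:ℝ) ≤ α - p := by linarith
          have := hxb n hn i v hv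
          have := hyb n i ⌊s n * v⌋₊
          gcongr
      _ = W ^ α * (1 + (i:ℝ)) ^ (-(β₁ * (α - p))) * v ^ (-(β₂ * p)) := by
          rw [Real.mul_rpow hW0.le (by positivity), Real.mul_rpow hW0.le (by positivity),
            ← Real.rpow_mul hv.le, ← Real.rpow_mul hi0, neg_mul, neg_mul]
          have : W ^ α = W ^ p * W ^ (α - p) := by
            rw [← Real.rpow_add hW0]; congr 1; ring
          rw [this]; ring
      _ ≤ b i * v ^ (-(β₂ * p)) := by
          simp only [b]
          gcongr
  have hFb : ∀ n, 1 ≤ n → ∀ i, ∀ v, 0 < v → ‖F n i v‖ ≤ b i * g v := by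
    intro n hn i v hv
    rw [Real.norm_eq_abs]
    simp only [g]
    split_ifs
    · exact hFp p₁ le_rfl (by linarith) n hn i v hv
    · exact hFp p₂ (by linarith) le_rfl n hn i v hv
  have hFm : ∀ n i, Measurable (F n i) := by
    intro n i
    exact (measurable_from_nat (f := fun k : ℕ =>
      V α ((m n : ℝ) ^ β₂ * c (i + n) k) ((m n : ℝ) ^ β₂ * c i (k + m n)))).comp
      (Nat.measurable_floor.comp (measurable_const_mul (s n)))
  have hFi : ∀ n, 1 ≤ n → ∀ i, IntegrableOn (F n i) (Ioi 0) := by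
    intro n hn i
    refine Integrable.mono' (hg.const_mul (b i)) (hFm n i).aestronglyMeasurable ?_
    exact (ae_restrict_mem measurableSet_Ioi).mono fun v hv => hFb n hn i v hv
  -- identity
  have hid : ∀ n, 1 ≤ n → ρ n (m n) / ((n : ℝ) ^ (-(β₁ / β₂)) * (m n : ℝ) ^ (1 - β₂ * α)) =
      ∑' i, ∫ v in Ioi (0:ℝ), F n i v := by
    intro n hn
    have h0 : (0:ℝ) < n := by exact_mod_cast hn
    have hmm := hm0 n
    have hden : (n : ℝ) ^ (-(β₁ / β₂)) * (m n : ℝ) ^ (1 - β₂ * α) =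
        s n * ((m n : ℝ) ^ (β₂ * α))⁻¹ := by
      rw [Real.rpow_sub hmm, Real.rpow_one]; simp only [hs]; ring
    rw [hρ n (m n) hn (hm n), hden, ← tsum_div_const]
    congr 1; ext i
    have hF : ∀ k : ℕ, V α ((m n : ℝ) ^ β₂ * c (i + n) k) ((m n : ℝ) ^ β₂ * c i (k + m n)) =
        (m n : ℝ) ^ (β₂ * α) * V α (c (i + n) k) (c i (k + m n)) := fun k => by
      rw [V_smul _ _ _ _ (by positivity), ← Real.rpow_mul hmm.le]
    have key := tsum_eq_integral_floor (fun k : ℕ =>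
      V α ((m n : ℝ) ^ β₂ * c (i + n) k) ((m n : ℝ) ^ β₂ * c i (k + m n))) (s n) (hs0 n hn)
      (hFi n hn i)
    simp only [hF] at key
    rw [tsum_mul_left] at key
    simp only [F, hF]
    have hpos : (0:ℝ) < (m n : ℝ) ^ (β₂ * α) := by positivity
    have := hs0 n hn
    rw [div_eq_iff (by positivity)]
    field_simp
    rw [mul_comm, key]
  have hpt : ∀ i v, 0 < v → Tendsto (fun n => F n i v) atTop
      (nhds (V α (v ^ (-β₂)) (winf i * (1 + (i : ℝ)) ^ (-β₁)))) := by
    intro i v hv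
    have hfl : Tendsto (fun n => ⌊s n * v⌋₊) atTop atTop :=
      tendsto_nat_floor_atTop.comp (hs_lim.atTop_mul_const hv)
    have hk : Tendsto (fun n => (1 + (⌊s n * v⌋₊ : ℝ)) / s n) atTop (nhds v) := by
      have h1 := (tendsto_nat_floor_mul_div_atTop hv.le).comp hs_lim
      have h2 := (tendsto_inv_atTop_zero.comp hs_lim).add h1
      rw [zero_add] at h2
      refine h2.congr ?_
      intro n
      simp only [Function.comp]
      rw [mul_comm v]; ring
    apply V_tendsto _ _ _ _ _ (by positivity)
    · have hw1 : Tendsto (fun n => w (i + n) ⌊s n * v⌋₊) atTop (nhds 1) :=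
        hA1.comp ((tendsto_add_atTop_nat i |>.congr (fun n => add_comm n i)).prodMk hfl)
      have hn1 : Tendsto (fun n : ℕ => (1 + ((i + n : ℕ) : ℝ)) / n) atTop (nhds 1) := by
        have h1 := (tendsto_const_div_atTop_nhds_zero_nat (1 + (i:ℝ))).add_const 1
        rw [zero_add] at h1
        refine h1.congr' ?_
        filter_upwards [eventually_ge_atTop 1] with n hn
        have h0 : (n:ℝ) ≠ 0 := by
          have : (0:ℝ) < n := by exact_mod_cast hn
          exact this.ne'
        push_cast
        field_simp
        ring
      have h := (hw1.mul (hn1.rpow_const (p := -β₁) (Or.inl one_ne_zero))).mul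
        (hk.rpow_const (p := -β₂) (Or.inl hv.ne'))
      rw [Real.one_rpow, one_mul, one_mul] at h
      refine h.congr' ?_
      filter_upwards [eventually_ge_atTop 1] with n hn
      have h0 : (0:ℝ) < n := by exact_mod_cast hn
      have hmm := hm0 n
      have hss := hs0 n hn
      rw [hc, Real.div_rpow (by positivity) h0.le, Real.div_rpow (by positivity) hss.le,
        hspow n hn, Real.rpow_neg hmm.le]
      have : (0:ℝ) < (m n : ℝ) ^ β₂ := by positivity
      have : (0:ℝ) < (n : ℝ) ^ (-β₁) := by positivity
      field_simp
    · have hw1 : Tendsto (fun n => w i (⌊s n * v⌋₊ + m n)) atTop (nhds (winf i)) :=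
        (hA2 i).comp (tendsto_atTop_mono (fun n => Nat.le_add_left _ _) hmtop)
      have hn1 : Tendsto (fun n : ℕ => (1 + ((⌊s n * v⌋₊ + m n : ℕ) : ℝ)) / m n) atTop
          (nhds 1) := by
        have h1 := (hk.mul hsm).add_const 1
        rw [mul_zero, zero_add] at h1
        refine h1.congr' ?_
        filter_upwards [eventually_ge_atTop 1] with n hn
        have hmm := hm0 n
        have hss := hs0 n hn
        push_cast
        field_simp
        ring
      have h := (hw1.mul_const ((1 + (i : ℝ)) ^ (-β₁))).mul
        (hn1.rpow_const (p := -β₂) (Or.inl one_ne_zero))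
      rw [Real.one_rpow, mul_one] at h
      refine h.congr ?_
      intro n
      have hmm := hm0 n
      rw [hc, Real.div_rpow (by positivity) hmm.le, Real.rpow_neg hmm.le, div_inv_eq_mul]
      ring
  have hint : ∀ i, Tendsto (fun n => ∫ v in Ioi (0:ℝ), F n i v) atTop
      (nhds (∫ v in Ioi (0 : ℝ), V α (v ^ (-β₂)) (winf i * (1 + (i : ℝ)) ^ (-β₁)))) := by
    intro i
    refine tendsto_integral_filter_of_dominated_convergence (fun v => b i * g v)
      (Eventually.of_forall fun n => (hFm n i).aestronglyMeasurable) ?_ (hg.const_mul (b i)) ?_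
    · filter_upwards [eventually_ge_atTop 1] with n hn
      exact (ae_restrict_mem measurableSet_Ioi).mono fun v hv => hFb n hn i v hv
    · exact (ae_restrict_mem measurableSet_Ioi).mono fun v hv => hpt i v hv
  have hbsum : Summable (fun i => b i * ∫ v in Ioi (0:ℝ), g v) := by
    apply Summable.mul_right
    apply Summable.mul_left
    have h1 : 1 < β₁ * (α - p₂) := by
      have : 1 / β₁ < α - p₂ := by linarith
      rw [div_lt_iff₀ hβ₁] at this
      linarith
    have h2 := (summable_nat_add_iff 1).mpr (Real.summable_nat_rpow.mpr (neg_lt_neg h1))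
    refine h2.congr ?_
    intro i
    push_cast
    rw [add_comm]
  have hfin := tendsto_tsum_of_dominated_convergence (𝓕 := atTop)
    (f := fun n i => ∫ v in Ioi (0:ℝ), F n i v) hbsum hint (by
      filter_upwards [eventually_ge_atTop 1] with n hn i
      rw [← integral_const_mul]
      refine norm_integral_le_of_norm_le (hg.const_mul (b i)) ?_
      exact (ae_restrict_mem measurableSet_Ioi).mono fun v hv => hFb n hn i v hv)
  refine hfin.congr' ?_
  filter_upwards [eventually_ge_atTop 1] with n hn
  rw [hid n hn]

theorem stmt14 (α β₁ β₂ : ℝ)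
    (hcond : (1 < α ∧ α < 2 ∧ 1 < β₁ ∧ β₁ < 1 / (α - 1) ∧ 1 < β₂ ∧
        β₂ < 1 / (α - 1) ∧ 1 / β₁ + 1 / β₂ < α) ∨
      (0 < α ∧ α ≤ 1 ∧ 1 / α < β₁ ∧ 1 / α < β₂ ∧ 1 / β₁ + 1 / β₂ < α))
    (w : ℕ → ℕ → ℝ) (hw : ∀ i j, w i j ≠ 0)
    (hA1 : Tendsto (fun p : ℕ × ℕ => w p.1 p.2) (atTop ×ˢ atTop) (nhds 1))
    (winf : ℕ → ℝ)
    (hA2 : ∀ i, Tendsto (fun j => w i j) atTop (nhds (winf i)) ∧ 0 < winf i)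
    (wco : ℕ → ℝ)
    (hA3 : ∀ j, Tendsto (fun i => w i j) atTop (nhds (wco j)) ∧ 0 < wco j)
    (c : ℕ → ℕ → ℝ)
    (hc : ∀ i j, c i j = w i j * (1 + (i : ℝ)) ^ (-β₁) * (1 + (j : ℝ)) ^ (-β₂))
    (ρ : ℕ → ℕ → ℝ)
    (hsum : ∀ n m : ℕ, 1 ≤ n → 1 ≤ m →
      Summable (fun q : ℕ × ℕ => V α (c (q.1 + n) q.2) (c q.1 (q.2 + m))))
    (hρ : ∀ n m : ℕ, 1 ≤ n → 1 ≤ m →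
      ρ n m = ∑' i : ℕ, ∑' j : ℕ, V α (c (i + n) j) (c i (j + m)))
    (m : ℕ → ℕ) (hm : ∀ n, 1 ≤ m n)
    (hratio : Tendsto (fun n : ℕ => (m n : ℝ) ^ (-β₂) / (n : ℝ) ^ (-β₁))
      atTop (nhds 0))
    :
    Tendsto (fun n : ℕ => ρ n (m n) / ((n : ℝ) ^ (-(β₁ / β₂)) * (m n : ℝ) ^ (1 - β₂ * α)))
      atTop
      (nhds (∑' i : ℕ, ∫ v in Ioi (0 : ℝ), V α (v ^ (-β₂)) (winf i * (1 + (i : ℝ)) ^ (-β₁)))) := by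
  have key : 0 < β₁ ∧ 0 < β₂ ∧ α - 1 < 1 / β₂ ∧ 1 / β₂ < 1 ∧ 1 / β₁ + 1 / β₂ < α := by
    rcases hcond with ⟨h1, h2, h3, h4, h5, h6, h7⟩ | ⟨h1, h2, h3, h4, h5⟩
    · have hb : 0 < β₂ := by linarith
      have ha : 0 < α - 1 := by linarith
      refine ⟨by linarith, hb, ?_, ?_, h7⟩
      · rw [lt_div_iff₀ ha] at h6
        rw [lt_div_iff₀ hb]; linarith
      · rw [div_lt_one hb]; exact h5
    · have ha : 1 ≤ 1 / α := by rw [le_div_iff₀ h1]; linarith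
      have hb : 0 < β₂ := by linarith
      refine ⟨by linarith, hb, ?_, ?_, h5⟩
      · have : 0 < 1 / β₂ := by positivity
        linarith
      · have hb1 : 0 < 1 / β₁ := by
          have : 0 < β₁ := by linarith
          positivity
        linarith
  obtain ⟨hb1, hb2, h1, h2, h3⟩ := key
  obtain ⟨W, hW0, hW⟩ := w_bdd w hA1 winf (fun i => (hA2 i).1) wco (fun j => (hA3 j).1)
  have hpos : 0 < 1 / β₂ := by positivity
  obtain ⟨p₁, hp1, hp1'⟩ := exists_between (max_lt h1 hpos)
  obtain ⟨p₂, hp2, hp2'⟩ := exists_between (lt_min h2 (show 1 / β₂ < α - 1 / β₁ by linarith))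
  exact main_aux α β₁ β₂ p₁ p₂ hb1 hb2 ((le_max_left _ _).trans hp1.le)
    ((le_max_right _ _).trans hp1.le) hp1' hp2 (hp2'.le.trans (min_le_left _ _))
    (hp2'.trans_le (min_le_right _ _)) w hA1 winf (fun i => (hA2 i).1) W hW0 hW c hc ρ hρ m hm hratio
end

section
/- Let 1 < α < 2, β₁ = 1/(α−1) and 1 < β₂ < 1/(α−1), and let (m_n) be a sequence of positive integers with m_n → ∞ and m_n^{−β₂}/n^{−β₁} → ∞ as n → ∞. Then lim_{n→∞} ρ(n,−m_n)/(n^{1−β₁α} m_n^{−β₂/β₁} ln(n · m_n^{−β₂/β₁})) = Σ_{j=0}^∞ w_{(∞,j)} (1+j)^{−β₂}. -/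
open Filter MeasureTheory Real Set

lemma aux_harm (K : ℕ) : ∑ i ∈ Finset.range K, 1 / (1 + (i : ℝ)) = ((harmonic K : ℚ) : ℝ) := by
  unfold harmonic
  push_cast
  refine Finset.sum_congr rfl fun i _ => ?_
  rw [one_div, add_comm]

lemma aux_tele (p : ℝ) (hp : 0 < p) (k : ℕ) (hk : 1 ≤ k) :
    p * (1 + (k : ℝ)) ^ (-(1 + p)) ≤ (k : ℝ) ^ (-p) - ((k : ℝ) + 1) ^ (-p) := by
  have hk' : (0 : ℝ) < k := by exact_mod_cast hk
  have h1 : (k : ℝ) ≤ (1 + k) * exp (-(1 / (1 + (k : ℝ)))) := by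
    have := Real.add_one_le_exp (-(1 / (1 + (k : ℝ))))
    calc (k : ℝ) = (1 + k) * (-(1 / (1 + (k : ℝ))) + 1) := by field_simp; ring
      _ ≤ _ := by gcongr
  have h2 : ((1 + (k : ℝ)) * exp (-(1 / (1 + (k : ℝ))))) ^ (-p) ≤ (k : ℝ) ^ (-p) :=
    Real.rpow_le_rpow_of_nonpos hk' h1 (by linarith)
  rw [Real.mul_rpow (by positivity) (by positivity), ← Real.exp_mul] at h2
  have h3 : 1 + p / (1 + (k : ℝ)) ≤ exp (-(1 / (1 + (k : ℝ))) * -p) := by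
    have := Real.add_one_le_exp (-(1 / (1 + (k : ℝ))) * -p)
    calc _ = -(1 / (1 + (k : ℝ))) * -p + 1 := by ring
      _ ≤ _ := this
  have h4 : (1 + (k : ℝ)) ^ (-(1 + p)) = (1 + (k : ℝ)) ^ (-p) / (1 + k) := by
    rw [show -(1 + p) = -p - 1 by ring, Real.rpow_sub_one (by positivity)]
  have h5 : (1 + (k : ℝ)) ^ (-p) * (1 + p / (1 + (k : ℝ))) ≤ (k : ℝ) ^ (-p) :=
    le_trans (by gcongr) h2
  rw [h4, add_comm (k : ℝ) 1]
  have : p * ((1 + (k : ℝ)) ^ (-p) / (1 + k)) =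
    (1 + (k : ℝ)) ^ (-p) * (1 + p / (1 + (k : ℝ))) - (1 + (k : ℝ)) ^ (-p) := by ring
  linarith

lemma aux_tail (p : ℝ) (hp : 0 < p) (K : ℕ) (hK : 1 ≤ K) :
    ∑' i : ℕ, (1 + ((i + K : ℕ) : ℝ)) ^ (-(1 + p)) ≤ (K : ℝ) ^ (-p) / p := by
  refine Real.tsum_le_of_sum_range_le (fun i => by positivity) fun n => ?_
  have h : ∀ i ∈ Finset.range n, (1 + ((i + K : ℕ) : ℝ)) ^ (-(1 + p)) ≤
      (fun i : ℕ => ((i + K : ℕ) : ℝ) ^ (-p) / p) i - (fun i : ℕ => ((i + K : ℕ) : ℝ) ^ (-p) / p) (i+1) := by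
    intro i _
    have := aux_tele p hp (i + K) (by omega)
    have e : ((i + 1 + K : ℕ) : ℝ) = ((i + K : ℕ) : ℝ) + 1 := by push_cast; ring
    simp only
    rw [e, ← sub_div, le_div_iff₀ hp]
    linarith
  refine (Finset.sum_le_sum h).trans ?_
  rw [Finset.sum_range_sub']
  simp only [zero_add]
  have : (0:ℝ) ≤ ((n + K : ℕ) : ℝ) ^ (-p) / p := by positivity
  linarith

lemma aux_summ (q : ℝ) (hq : 1 < q) : Summable fun j : ℕ => (1 + (j : ℝ)) ^ (-q) := by
  have := (Real.summable_one_div_nat_add_rpow 1 q).2 hq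
  refine this.congr fun j => ?_
  rw [abs_of_nonneg (by positivity), Real.rpow_neg (by positivity), one_div, add_comm]

lemma aux_abstract (T : ℕ → ℝ) (hT : Tendsto T atTop atTop) (A : ℕ → ℕ → ℝ) (C p S : ℝ)
    (hC : 0 ≤ C) (hp : 0 < p)
    (h1 : ∀ n, 1 ≤ n → ∀ i : ℕ, |A n i| ≤ C * (1 / (1 + (i : ℝ))))
    (h2 : ∀ n, 1 ≤ n → ∀ i : ℕ, |A n i| ≤ C * (T n) ^ p * (1 + (i : ℝ)) ^ (-(1 + p)))
    (h3 : ∀ ε > 0, ∃ δ > 0, ∃ N : ℕ, ∀ n ≥ N, ∀ i : ℕ, N ≤ i → (i : ℝ) ≤ δ * T n →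
      |(1 + (i : ℝ)) * A n i - S| ≤ ε) :
    Tendsto (fun n => (∑' i, A n i) / Real.log (T n)) atTop (nhds S) := by
  have hlog : Tendsto (fun n => Real.log (T n)) atTop atTop := Real.tendsto_log_atTop.comp hT
  -- main estimate
  have key : ∀ ε > 0, ∃ D : ℝ, ∀ᶠ n in atTop,
      |(∑' i, A n i) - S * Real.log (T n)| ≤ D + ε * Real.log (T n) := by
    intro ε hε
    obtain ⟨δ₀, hδ₀, N, hN⟩ := h3 ε hε
    set δ := min δ₀ 1 with hδdef
    have hδ : 0 < δ := lt_min hδ₀ one_pos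
    have hδ1 : δ ≤ 1 := min_le_right _ _
    refine ⟨(C + |S|) * N + ε + (C + |S|) * (1 - Real.log δ) + |S| + C * (2 ^ p / p), ?_⟩
    filter_upwards [eventually_ge_atTop N, eventually_ge_atTop 1, hT.eventually_ge_atTop 1]
      with n hnN hn1 hTn
    set t := T n with ht
    have ht0 : 0 < t := by linarith
    set K := ⌊t⌋₊ with hK
    set J := ⌊δ * t⌋₊ with hJ
    have hK1 : 1 ≤ K := Nat.le_floor (by simpa using hTn)
    have hKt : (K : ℝ) ≤ t := Nat.floor_le ht0.le
    have htK : t < (K : ℝ) + 1 := Nat.lt_floor_add_one t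
    have htJ : δ * t < (J : ℝ) + 1 := Nat.lt_floor_add_one _
    have hJK : J ≤ K := Nat.floor_le_floor (by nlinarith)
    have hs : Summable (A n) := by
      refine Summable.of_norm_bounded ((aux_summ (1 + p) (by linarith)).mul_left (C * t ^ p)) ?_
      intro i; exact h2 n hn1 i
    rw [← hs.sum_add_tsum_nat_add K]
    have hH1 : Real.log t ≤ ∑ i ∈ Finset.range K, 1 / (1 + (i : ℝ)) := by
      rw [aux_harm]
      refine le_trans (Real.log_le_log ht0 ?_) (log_add_one_le_harmonic K)
      push_cast; exact htK.le
    have hH2 : ∑ i ∈ Finset.range K, 1 / (1 + (i : ℝ)) ≤ 1 + Real.log t := by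
      rw [aux_harm]
      refine (harmonic_le_one_add_log K).trans ?_
      gcongr
    have hHJ : Real.log δ + Real.log t ≤ ∑ i ∈ Finset.range J, 1 / (1 + (i : ℝ)) := by
      rw [aux_harm, ← Real.log_mul hδ.ne' ht0.ne']
      refine le_trans (Real.log_le_log (by positivity) ?_) (log_add_one_le_harmonic J)
      push_cast; exact htJ.le
    have hIco : ∑ i ∈ Finset.Ico J K, 1 / (1 + (i : ℝ)) ≤ 1 - Real.log δ := by
      have := Finset.sum_range_add_sum_Ico (fun i : ℕ => 1 / (1 + (i : ℝ))) hJK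
      linarith
    -- tail
    have htail : |∑' i, A n (i + K)| ≤ C * (2 ^ p / p) := by
      have hsum' : Summable fun i : ℕ => (1 + ((i + K : ℕ) : ℝ)) ^ (-(1 + p)) :=
        (summable_nat_add_iff K).2 (aux_summ (1 + p) (by linarith))
      have := tsum_of_norm_bounded (hsum'.mul_left (C * t ^ p)).hasSum
        (f := fun i => A n (i + K)) (fun i => h2 n hn1 (i + K))
      rw [Real.norm_eq_abs] at this
      refine this.trans ?_
      rw [tsum_mul_left]
      have h6 := aux_tail p hp K hK1
      have hK0 : (0 : ℝ) < K := by exact_mod_cast hK1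
      have hK1' : (1 : ℝ) ≤ K := by exact_mod_cast hK1
      calc C * t ^ p * ∑' i : ℕ, (1 + ((i + K : ℕ) : ℝ)) ^ (-(1 + p))
          ≤ C * (2 * K) ^ p * ((K : ℝ) ^ (-p) / p) := by
            gcongr
            linarith
        _ = C * (2 ^ p / p) := by
            rw [Real.mul_rpow (by norm_num) hK0.le, Real.rpow_neg hK0.le]
            have : (K : ℝ) ^ p ≠ 0 := by positivity
            field_simp
    -- middle
    have hmid : |∑ i ∈ Finset.range K, A n i - S * ∑ i ∈ Finset.range K, 1 / (1 + (i : ℝ))| ≤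
        (C + |S|) * N + ε * (1 + Real.log t) + (C + |S|) * (1 - Real.log δ) := by
      rw [Finset.mul_sum, ← Finset.sum_sub_distrib]
      refine (Finset.abs_sum_le_sum_abs _ _).trans ?_
      have hpt : ∀ i ∈ Finset.range K, |A n i - S * (1 / (1 + (i : ℝ)))| ≤
          (C + |S|) * (if i ∈ Finset.range N then 1 else 0) + ε * (1 / (1 + (i : ℝ))) +
          (C + |S|) * (if i ∈ Finset.Ico J K then 1 / (1 + (i : ℝ)) else 0) := by
        intro i hi
        have hi0 : (0 : ℝ) < 1 + i := by positivity
        have hq : 0 < 1 / (1 + (i : ℝ)) := by positivity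
        have hCS : 0 ≤ C + |S| := by positivity
        have hgen : |A n i - S * (1 / (1 + (i : ℝ)))| ≤ (C + |S|) * (1 / (1 + (i : ℝ))) := by
          refine (abs_sub _ _).trans ?_
          rw [abs_mul, abs_of_pos hq, add_mul]
          gcongr
          exact h1 n hn1 i
        have t3 : 0 ≤ (C + |S|) * (if i ∈ Finset.Ico J K then 1 / (1 + (i : ℝ)) else 0) := by
          split_ifs <;> positivity
        have t1 : 0 ≤ (C + |S|) * (if i ∈ Finset.range N then (1 : ℝ) else 0) := by
          split_ifs <;> positivity
        have t2 : 0 ≤ ε * (1 / (1 + (i : ℝ))) := by positivity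
        by_cases hiN : i < N
        · have hq1 : 1 / (1 + (i : ℝ)) ≤ 1 := by
            rw [div_le_one hi0]; have : (0:ℝ) ≤ i := by positivity
            linarith
          have : (C + |S|) * (1 / (1 + (i : ℝ))) ≤ (C + |S|) * 1 := by gcongr
          rw [if_pos (Finset.mem_range.2 hiN)]
          linarith
        · push Not at hiN
          by_cases hid : (i : ℝ) ≤ δ * t
          · have := hN n hnN i hiN (hid.trans (by gcongr; exact min_le_left _ _))
            have e : A n i - S * (1 / (1 + (i : ℝ))) = ((1 + (i : ℝ)) * A n i - S) * (1 / (1 + (i : ℝ))) := by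
              field_simp
            have : |A n i - S * (1 / (1 + (i : ℝ)))| ≤ ε * (1 / (1 + (i : ℝ))) := by
              rw [e, abs_mul, abs_of_pos hq]; gcongr
            linarith
          · push Not at hid
            have : i ∈ Finset.Ico J K := by
              rw [Finset.mem_Ico]
              refine ⟨?_, Finset.mem_range.1 hi⟩
              have : (J : ℝ) ≤ δ * t := Nat.floor_le (by positivity)
              exact_mod_cast (this.trans hid.le)
            rw [if_pos this]
            linarith
      refine (Finset.sum_le_sum hpt).trans ?_
      rw [Finset.sum_add_distrib, Finset.sum_add_distrib, ← Finset.mul_sum, ← Finset.mul_sum,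
        ← Finset.mul_sum]
      have hCS : 0 ≤ C + |S| := by positivity
      gcongr
      · rw [Finset.sum_ite_mem, Finset.sum_const, nsmul_eq_mul, mul_one]
        exact_mod_cast (Finset.card_le_card Finset.inter_subset_right).trans (by simp)
      · rw [Finset.sum_ite_mem]
        refine le_trans (Finset.sum_le_sum_of_subset_of_nonneg Finset.inter_subset_right ?_) hIco
        intros; positivity
    have hS : |S * ∑ i ∈ Finset.range K, 1 / (1 + (i : ℝ)) - S * Real.log t| ≤ |S| := by
      rw [← mul_sub, abs_mul]
      have : |∑ i ∈ Finset.range K, 1 / (1 + (i : ℝ)) - Real.log t| ≤ 1 := by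
        rw [abs_le]; constructor <;> linarith
      nlinarith [abs_nonneg S]
    have e : ∑ i ∈ Finset.range K, A n i + ∑' i, A n (i + K) - S * Real.log t =
      (∑ i ∈ Finset.range K, A n i - S * ∑ i ∈ Finset.range K, 1 / (1 + (i : ℝ))) +
      (S * ∑ i ∈ Finset.range K, 1 / (1 + (i : ℝ)) - S * Real.log t) + ∑' i, A n (i + K) := by ring
    rw [e]
    refine (abs_add_three _ _ _).trans ?_
    linarith
  rw [Metric.tendsto_atTop']
  intro ε hε
  obtain ⟨D, hD⟩ := key (ε / 2) (by positivity)
  have := (hD.and (hlog.eventually_gt_atTop (max 0 (2 * D / ε)))).and (eventually_gt_atTop 0)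
  obtain ⟨N, hN⟩ := eventually_atTop.1 this
  refine ⟨N, fun n hn => ?_⟩
  obtain ⟨⟨hd, hl⟩, -⟩ := hN n hn.le
  have hl0 : 0 < Real.log (T n) := lt_of_le_of_lt (le_max_left _ _) hl
  have hl1 : 2 * D / ε < Real.log (T n) := lt_of_le_of_lt (le_max_right _ _) hl
  rw [div_lt_iff₀ hε] at hl1
  rw [Real.dist_eq, div_sub' hl0.ne', abs_div, abs_of_pos hl0, div_lt_iff₀ hl0, mul_comm (Real.log (T n))]
  nlinarith

lemma aux_bound (X Y r γ θ : ℝ) (hX : X ≠ 0) (hY : Y ≠ 0) (hr : 0 < r) (hθ : 0 ≤ θ) (hθγ : θ ≤ γ) :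
    |X * Y * ((r * X) ^ 2 + Y ^ 2) ^ (-(γ / 2))| ≤ |X| ^ (1 - θ) * r ^ (-θ) * |Y| ^ (1 - γ + θ) := by
  have hX' : 0 < |X| := abs_pos.2 hX
  have hY' : 0 < |Y| := abs_pos.2 hY
  have hQ : 0 < (r * X) ^ 2 + Y ^ 2 := by positivity
  set R := √((r * X) ^ 2 + Y ^ 2) with hR
  have hR0 : 0 < R := Real.sqrt_pos.2 hQ
  have a1 : r * |X| ≤ R := by
    rw [hR]; apply Real.le_sqrt_of_sq_le; rw [mul_pow, mul_pow, sq_abs]; nlinarith [sq_nonneg Y]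
  have a2 : |Y| ≤ R := by
    rw [hR]; apply Real.le_sqrt_of_sq_le; rw [sq_abs]; nlinarith [sq_nonneg (r * X)]
  have e1 : ((r * X) ^ 2 + Y ^ 2) ^ (-(γ / 2)) = R ^ (-γ) := by
    rw [hR, Real.sqrt_eq_rpow, ← Real.rpow_mul hQ.le]; congr 1; ring
  have e2 : R ^ (-γ) = R ^ (-θ) * R ^ (-(γ - θ)) := by
    rw [← Real.rpow_add hR0]; congr 1; ring
  rw [e1, abs_mul, abs_mul, abs_of_pos (by positivity : 0 < R ^ (-γ)), e2]
  have b1 : R ^ (-θ) ≤ (r * |X|) ^ (-θ) :=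
    Real.rpow_le_rpow_of_nonpos (by positivity) a1 (by linarith)
  have b2 : R ^ (-(γ - θ)) ≤ |Y| ^ (-(γ - θ)) :=
    Real.rpow_le_rpow_of_nonpos (by positivity) a2 (by linarith)
  calc |X| * |Y| * (R ^ (-θ) * R ^ (-(γ - θ)))
      ≤ |X| * |Y| * ((r * |X|) ^ (-θ) * |Y| ^ (-(γ - θ))) := by gcongr
    _ = (|X| * |X| ^ (-θ)) * r ^ (-θ) * (|Y| * |Y| ^ (-(γ - θ))) := by
        rw [Real.mul_rpow hr.le hX'.le]; ring
    _ = _ := by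
        rw [show 1 - θ = 1 + -θ by ring, show 1 - γ + θ = 1 + -(γ - θ) by ring,
          Real.rpow_add hX', Real.rpow_add hY', Real.rpow_one, Real.rpow_one]

lemma aux_wbdd (w : ℕ → ℕ → ℝ)
    (hA1 : Tendsto (fun p : ℕ × ℕ => w p.1 p.2) (atTop ×ˢ atTop) (nhds 1))
    (winf : ℕ → ℝ) (hA2 : ∀ i, Tendsto (fun j => w i j) atTop (nhds (winf i)) ∧ 0 < winf i)
    (wco : ℕ → ℝ) (hA3 : ∀ j, Tendsto (fun i => w i j) atTop (nhds (wco j)) ∧ 0 < wco j) :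
    ∃ W : ℝ, 1 ≤ W ∧ ∀ i j, |w i j| ≤ W := by
  have hb : ∀ (u : ℕ → ℝ) (a : ℝ), Tendsto u atTop (nhds a) → ∃ B, 0 ≤ B ∧ ∀ k, |u k| ≤ B := by
    intro u a h
    obtain ⟨B, hB⟩ := h.abs.bddAbove_range
    have : ∀ k, |u k| ≤ B := fun k => hB ⟨k, rfl⟩
    exact ⟨B, (abs_nonneg _).trans (this 0), this⟩
  choose B hB0 hB using fun i => hb _ _ (hA2 i).1
  choose D hD0 hD using fun j => hb _ _ (hA3 j).1
  have h := hA1.abs.eventually_lt_const (u := 2) (by norm_num)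
  rw [prod_atTop_atTop_eq, eventually_atTop] at h
  obtain ⟨⟨N, M⟩, hNM⟩ := h
  have s1 : 0 ≤ ∑ i ∈ Finset.range N, B i := Finset.sum_nonneg fun i _ => hB0 i
  have s2 : 0 ≤ ∑ i ∈ Finset.range M, D i := Finset.sum_nonneg fun i _ => hD0 i
  refine ⟨2 + ∑ i ∈ Finset.range N, B i + ∑ j ∈ Finset.range M, D j, by linarith, fun i j => ?_⟩
  by_cases hi : i < N
  · have := Finset.single_le_sum (fun i _ => hB0 i) (Finset.mem_range.2 hi)
    have := hB i j
    linarith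
  by_cases hj : j < M
  · have := Finset.single_le_sum (fun i _ => hD0 i) (Finset.mem_range.2 hj)
    have := hD j i
    linarith
  have := hNM (i, j) ⟨not_lt.1 hi, not_lt.1 hj⟩
  simp only at this
  linarith

lemma aux_V (α μ r X Y : ℝ) (hμ : 0 < μ) (hY : Y ≠ 0) :
    V α (μ * r * X) (μ * Y) =
      μ * r * μ ^ (α - 1) * (X * Y * ((r * X) ^ 2 + Y ^ 2) ^ (-((2 - α) / 2))) := by
  have hQ : 0 < (r * X) ^ 2 + Y ^ 2 := by positivity
  have hne : ¬ (μ * r * X = 0 ∧ μ * Y = 0) := fun h => (mul_ne_zero hμ.ne' hY) h.2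
  unfold V
  rw [if_neg hne]
  have e : (μ * r * X) ^ 2 + (μ * Y) ^ 2 = μ ^ (2 : ℝ) * ((r * X) ^ 2 + Y ^ 2) := by
    rw [Real.rpow_two]; ring
  rw [e, div_eq_mul_inv, ← Real.rpow_neg (by positivity), Real.mul_rpow (by positivity) hQ.le,
    ← Real.rpow_mul hμ.le, show 2 * -((2 - α) / 2) = (α - 1) - 1 by ring,
    Real.rpow_sub_one hμ.ne']
  field_simp

set_option maxHeartbeats 2000000 in
theorem stmt19 (α β₁ β₂ : ℝ)
    (hα : 1 < α) (hα2 : α < 2)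
    (hβ₁ : β₁ = 1 / (α - 1)) (hβ₂l : 1 < β₂) (hβ₂u : β₂ < 1 / (α - 1))
    (w : ℕ → ℕ → ℝ) (hw : ∀ i j, w i j ≠ 0)
    (hA1 : Tendsto (fun p : ℕ × ℕ => w p.1 p.2) (atTop ×ˢ atTop) (nhds 1))
    (winf : ℕ → ℝ)
    (hA2 : ∀ i, Tendsto (fun j => w i j) atTop (nhds (winf i)) ∧ 0 < winf i)
    (wco : ℕ → ℝ)
    (hA3 : ∀ j, Tendsto (fun i => w i j) atTop (nhds (wco j)) ∧ 0 < wco j)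
    (c : ℕ → ℕ → ℝ)
    (hc : ∀ i j, c i j = w i j * (1 + (i : ℝ)) ^ (-β₁) * (1 + (j : ℝ)) ^ (-β₂))
    (ρ : ℕ → ℕ → ℝ)
    (hsum : ∀ n m : ℕ, 1 ≤ n → 1 ≤ m →
      Summable (fun q : ℕ × ℕ => V α (c (q.1 + n) q.2) (c q.1 (q.2 + m))))
    (hρ : ∀ n m : ℕ, 1 ≤ n → 1 ≤ m →
      ρ n m = ∑' i : ℕ, ∑' j : ℕ, V α (c (i + n) j) (c i (j + m)))
    (m : ℕ → ℕ) (hm : ∀ n, 1 ≤ m n)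
    (hminf : Tendsto (fun n => m n) atTop atTop)
    (hratio : Tendsto (fun n : ℕ => (m n : ℝ) ^ (-β₂) / (n : ℝ) ^ (-β₁))
      atTop atTop)
    :
    Tendsto (fun n : ℕ => ρ n (m n) / ((n : ℝ) ^ (1 - β₁ * α) * (m n : ℝ) ^ (-(β₂ / β₁)) *
        Real.log ((n : ℝ) * (m n : ℝ) ^ (-(β₂ / β₁)))))
      atTop
      (nhds (∑' j : ℕ, wco j * (1 + (j : ℝ)) ^ (-β₂))) := by
  obtain ⟨W, hW1, hW⟩ := aux_wbdd w hA1 winf hA2 wco hA3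
  have hα1 : 0 < α - 1 := by linarith
  rw [← hβ₁] at hβ₂u
  have hb0 : 0 < β₁ := by linarith
  have hbinv : α - 1 = 1 / β₁ := by rw [hβ₁]; field_simp
  have hexp : 1 - β₁ * α = -β₁ := by
    have : α = 1 + 1 / β₁ := by linarith
    rw [this]; field_simp; ring
  have hm0 : ∀ n, (0 : ℝ) < m n := fun n => by exact_mod_cast hm n
  set T : ℕ → ℝ := fun n => (n : ℝ) * (m n : ℝ) ^ (-(β₂ / β₁)) with hTdef
  have hTpos : ∀ n, 1 ≤ n → 0 < T n := fun n hn => by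
    have : (0 : ℝ) < n := by exact_mod_cast hn
    have := hm0 n
    simp only [hTdef]; positivity
  have hTb : ∀ n, 1 ≤ n → (T n) ^ β₁ = (n : ℝ) ^ β₁ * (m n : ℝ) ^ (-β₂) := fun n hn => by
    have := hm0 n
    simp only [hTdef]
    rw [Real.mul_rpow (by positivity) (by positivity), ← Real.rpow_mul (by positivity)]
    congr 2; field_simp
  have hTn : ∀ n, T n ≤ n := fun n => by
    have h1 : (1 : ℝ) ≤ m n := by exact_mod_cast hm n
    have : (m n : ℝ) ^ (-(β₂ / β₁)) ≤ 1 :=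
      Real.rpow_le_one_of_one_le_of_nonpos h1 (by rw [neg_nonpos]; positivity)
    simp only [hTdef]
    exact mul_le_of_le_one_right (by positivity) this
  have hT : Tendsto T atTop atTop := by
    have := (tendsto_rpow_atTop (y := 1 / β₁) (by positivity)).comp hratio
    refine this.congr' ?_
    filter_upwards [eventually_ge_atTop 1] with n hn
    have h0 := (hTpos n hn).le
    have hn0 : (0 : ℝ) < n := by exact_mod_cast hn
    simp only [Function.comp]
    rw [Real.rpow_neg hn0.le, div_inv_eq_mul, mul_comm, ← hTb n hn, ← Real.rpow_mul h0]
    rw [mul_one_div_cancel hb0.ne', Real.rpow_one]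
  -- normalised variables
  set X : ℕ → ℕ → ℕ → ℝ := fun n i j =>
    w (i + n) j * ((1 + (i : ℝ) + n) / n) ^ (-β₁) * (1 + (j : ℝ)) ^ (-β₂) with hX
  set Y : ℕ → ℕ → ℕ → ℝ := fun n i j =>
    w i (j + m n) * ((1 + (j : ℝ) + m n) / m n) ^ (-β₂) with hY
  set r : ℕ → ℕ → ℝ := fun n i => ((1 + (i : ℝ)) / T n) ^ β₁ with hr
  set G : ℕ → ℕ → ℕ → ℝ := fun n i j =>
    X n i j * Y n i j * ((r n i * X n i j) ^ 2 + (Y n i j) ^ 2) ^ (-((2 - α) / 2)) with hG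
  have hXne : ∀ n, 1 ≤ n → ∀ i j, X n i j ≠ 0 := fun n hn i j => by
    have hn0 : (0 : ℝ) < n := by exact_mod_cast hn
    have := hw (i + n) j
    simp only [hX]; positivity
  have hYne : ∀ n i j, Y n i j ≠ 0 := fun n i j => by
    have hn0 := hm0 n
    have := hw i (j + m n)
    simp only [hY]; positivity
  have hrpos : ∀ n, 1 ≤ n → ∀ i, 0 < r n i := fun n hn i => by
    have := hTpos n hn
    simp only [hr]; positivity
  have hXle : ∀ n, 1 ≤ n → ∀ i j, |X n i j| ≤ W * (1 + (j : ℝ)) ^ (-β₂) := fun n hn i j => by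
    have hn0 : (0 : ℝ) < n := by exact_mod_cast hn
    have h1 : ((1 + (i : ℝ) + n) / n) ^ (-β₁) ≤ 1 := by
      refine Real.rpow_le_one_of_one_le_of_nonpos ?_ (by linarith)
      rw [one_le_div hn0]; have : (0:ℝ) ≤ i := by positivity
      linarith
    simp only [hX]
    rw [abs_mul, abs_mul, abs_of_nonneg (a := (1 + (j : ℝ)) ^ (-β₂)) (by positivity),
      abs_of_nonneg (a := ((1 + (i : ℝ) + n) / n) ^ (-β₁)) (by positivity)]
    gcongr
    calc _ ≤ W * 1 := by
          gcongr
          exact hW _ _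
      _ = W := mul_one W
  have hYle : ∀ n i j, |Y n i j| ≤ W := fun n i j => by
    have hn0 := hm0 n
    have h1 : ((1 + (j : ℝ) + m n) / m n) ^ (-β₂) ≤ 1 := by
      refine Real.rpow_le_one_of_one_le_of_nonpos ?_ (by linarith)
      rw [one_le_div hn0]; have : (0:ℝ) ≤ j := by positivity
      linarith
    simp only [hY]
    rw [abs_mul, abs_of_nonneg (a := ((1 + (j : ℝ) + m n) / m n) ^ (-β₂)) (by positivity)]
    calc _ ≤ W * 1 := by
          gcongr
          exact hW _ _
      _ = W := mul_one W
  have hVG : ∀ n, 1 ≤ n → ∀ i j, V α (c (i + n) j) (c i (j + m n)) =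
      ((n : ℝ) ^ (-β₁) * (m n : ℝ) ^ (-(β₂ / β₁))) * ((1 / (1 + (i : ℝ))) * G n i j) := by
    intro n hn i j
    have hn0 : (0 : ℝ) < n := by exact_mod_cast hn
    have hmn := hm0 n
    have hi : (0 : ℝ) < 1 + i := by positivity
    set μ := (1 + (i : ℝ)) ^ (-β₁) * (m n : ℝ) ^ (-β₂) with hμ
    have hμ0 : 0 < μ := by positivity
    have hμr : μ * r n i = (n : ℝ) ^ (-β₁) := by
      simp only [hr]
      rw [Real.div_rpow hi.le (hTpos n hn).le, hTb n hn, hμ, Real.rpow_neg hi.le,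
        Real.rpow_neg hn0.le]
      have : (1 + (i : ℝ)) ^ β₁ ≠ 0 := by positivity
      have : (m n : ℝ) ^ (-β₂) ≠ 0 := by positivity
      field_simp
    have e1 : c (i + n) j = μ * r n i * X n i j := by
      rw [hμr, hc]
      simp only [hX]
      have : (1 + ((i + n : ℕ) : ℝ)) = n * ((1 + (i : ℝ) + n) / n) := by
        push_cast; field_simp; ring
      rw [this, Real.mul_rpow hn0.le (by positivity)]
      ring
    have e2 : c i (j + m n) = μ * Y n i j := by
      rw [hc]
      simp only [hY, hμ]
      have : (1 + ((j + m n : ℕ) : ℝ)) = m n * ((1 + (j : ℝ) + m n) / m n) := by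
        push_cast; field_simp; ring
      rw [this, Real.mul_rpow hmn.le (by positivity)]
      ring
    have e3 : μ ^ (α - 1) = 1 / (1 + (i : ℝ)) * (m n : ℝ) ^ (-(β₂ / β₁)) := by
      rw [hμ, hbinv, Real.mul_rpow (by positivity) (by positivity), ← Real.rpow_mul hi.le,
        ← Real.rpow_mul hmn.le, one_div (1 + (i : ℝ)), ← Real.rpow_neg_one (1 + (i : ℝ))]
      congr 2 <;> field_simp
    rw [e1, e2, aux_V α μ _ _ _ hμ0 (hYne n i j), e3, hμr]
    simp only [hG]
    ring
  -- bound for G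
  have hGle : ∀ θ, 0 ≤ θ → θ ≤ 2 - α → ∀ n, 1 ≤ n → ∀ i j,
      |G n i j| ≤ (W ^ 2 * r n i ^ (-θ)) * (1 + (j : ℝ)) ^ (-(β₂ * (1 - θ))) := by
    intro θ h0 h1 n hn i j
    have hr0 := hrpos n hn i
    have hj : (0 : ℝ) < 1 + j := by positivity
    have hW0 : 0 < W := by linarith
    refine (aux_bound _ _ _ _ θ (hXne n hn i j) (hYne n i j) hr0 h0 h1).trans ?_
    have a1 : |X n i j| ^ (1 - θ) ≤ W * (1 + (j : ℝ)) ^ (-(β₂ * (1 - θ))) := by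
      calc _ ≤ (W * (1 + (j : ℝ)) ^ (-β₂)) ^ (1 - θ) :=
            Real.rpow_le_rpow (abs_nonneg _) (hXle n hn i j) (by linarith)
        _ = W ^ (1 - θ) * (1 + (j : ℝ)) ^ (-(β₂ * (1 - θ))) := by
            rw [Real.mul_rpow hW0.le (by positivity), ← Real.rpow_mul hj.le, neg_mul]
        _ ≤ _ := by
            gcongr
            exact Real.rpow_le_self_of_one_le hW1 (by linarith)
    have a2 : |Y n i j| ^ (1 - (2 - α) + θ) ≤ W := by
      refine (Real.rpow_le_rpow (abs_nonneg _) (hYle n i j) (by linarith)).trans ?_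
      exact Real.rpow_le_self_of_one_le hW1 (by linarith)
    calc _ ≤ (W * (1 + (j : ℝ)) ^ (-(β₂ * (1 - θ)))) * r n i ^ (-θ) * W := by gcongr
      _ = _ := by ring
  set A : ℕ → ℕ → ℝ := fun n i => ∑' j, (1 / (1 + (i : ℝ))) * G n i j with hA
  have hAle : ∀ θ, 0 ≤ θ → θ ≤ 2 - α → 1 < β₂ * (1 - θ) → ∀ n, 1 ≤ n → ∀ i,
      |A n i| ≤ W ^ 2 * (∑' j : ℕ, (1 + (j : ℝ)) ^ (-(β₂ * (1 - θ)))) *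
        (r n i ^ (-θ) * (1 / (1 + (i : ℝ)))) := by
    intro θ h0 h1 h2 n hn i
    have hs := (aux_summ _ h2).mul_left (W ^ 2 * r n i ^ (-θ))
    have := tsum_of_norm_bounded (f := fun j => G n i j) hs.hasSum (fun j => hGle θ h0 h1 n hn i j)
    rw [tsum_mul_left, Real.norm_eq_abs] at this
    simp only [hA]
    rw [tsum_mul_left, abs_mul, abs_of_nonneg (by positivity)]
    calc _ ≤ 1 / (1 + (i : ℝ)) * (W ^ 2 * r n i ^ (-θ) *
          ∑' j : ℕ, (1 + (j : ℝ)) ^ (-(β₂ * (1 - θ)))) := by gcongr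
      _ = _ := by ring
  set θ := (1 - 1 / β₂) / 2 with hθ
  have hβ2inv : 1 / β₂ < 1 := by rw [div_lt_one (by linarith)]; exact hβ₂l
  have hbb : 1 / β₁ < 1 / β₂ := one_div_lt_one_div_of_lt (by linarith) hβ₂u
  have hθ0 : 0 < θ := by rw [hθ]; linarith
  have hθγ : θ ≤ 2 - α := by rw [hθ]; linarith
  have hθβ : 1 < β₂ * (1 - θ) := by
    have : β₂ * (1 / β₂) = 1 := by field_simp
    have : β₂ * (1 - θ) = (β₂ + 1) / 2 := by rw [hθ]; linear_combination this / 2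
    linarith
  set Z0 := ∑' j : ℕ, (1 + (j : ℝ)) ^ (-(β₂ * (1 - 0))) with hZ0
  set Z1 := ∑' j : ℕ, (1 + (j : ℝ)) ^ (-(β₂ * (1 - θ))) with hZ1
  have hZ00 : 0 ≤ Z0 := tsum_nonneg fun j => by positivity
  have hZ10 : 0 ≤ Z1 := tsum_nonneg fun j => by positivity
  have main := aux_abstract T hT A (W ^ 2 * (Z0 + Z1)) (β₁ * θ)
    (∑' j : ℕ, wco j * (1 + (j : ℝ)) ^ (-β₂)) (by positivity) (by positivity) ?_ ?_ ?_
  · refine main.congr' ?_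
    filter_upwards [eventually_ge_atTop 1] with n hn
    have hn0 : (0 : ℝ) < n := by exact_mod_cast hn
    have hmn := hm0 n
    have : ρ n (m n) = ((n : ℝ) ^ (-β₁) * (m n : ℝ) ^ (-(β₂ / β₁))) * ∑' i, A n i := by
      rw [hρ n (m n) hn (hm n), ← tsum_mul_left]
      refine tsum_congr fun i => ?_
      simp only [hA]
      rw [← tsum_mul_left]
      exact tsum_congr fun j => hVG n hn i j
    rw [this, hexp, mul_div_mul_left _ _ (by positivity)]
  · intro n hn i
    have := hAle 0 le_rfl (by linarith) (by linarith) n hn i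
    rw [neg_zero, Real.rpow_zero, one_mul] at this
    refine this.trans ?_
    gcongr
    linarith
  · intro n hn i
    have hTn0 := hTpos n hn
    refine (hAle θ hθ0.le hθγ hθβ n hn i).trans ?_
    have hi : (0 : ℝ) < 1 + i := by positivity
    have e : r n i ^ (-θ) * (1 / (1 + (i : ℝ))) =
        (T n) ^ (β₁ * θ) * (1 + (i : ℝ)) ^ (-(1 + β₁ * θ)) := by
      simp only [hr]
      rw [← Real.rpow_mul (by positivity), Real.div_rpow hi.le hTn0.le,
        show -(1 + β₁ * θ) = β₁ * -θ - 1 by ring, Real.rpow_sub_one hi.ne',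
        show β₁ * θ = -(β₁ * -θ) by ring, Real.rpow_neg hTn0.le]
      ring
    rw [e, ← mul_assoc]
    gcongr
    linarith
  · -- local convergence
    set Φ : ℕ × ℕ → ℕ × ℕ × ℝ := fun q => (q.1, q.2, (1 + (q.2 : ℝ)) / T q.1) with hΦ
    set l : Filter (ℕ × ℕ) := comap Φ (atTop ×ˢ atTop ×ˢ nhds 0) with hl
    have hΦt : Tendsto Φ l (atTop ×ˢ atTop ×ˢ nhds 0) := tendsto_comap
    have l1 : Tendsto (fun q : ℕ × ℕ => q.1) l atTop :=
      Tendsto.comp (f := Φ) (g := fun x => x.1) tendsto_fst hΦt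
    have l2 : Tendsto (fun q : ℕ × ℕ => q.2) l atTop :=
      Tendsto.comp (f := Φ) (g := fun x => x.2.1) (tendsto_fst.comp tendsto_snd) hΦt
    have l3 : Tendsto (fun q : ℕ × ℕ => (1 + (q.2 : ℝ)) / T q.1) l (nhds 0) :=
      Tendsto.comp (f := Φ) (g := fun x => x.2.2) (tendsto_snd.comp tendsto_snd) hΦt
    have l4 : Tendsto (fun q : ℕ × ℕ => (1 + (q.2 : ℝ)) / q.1) l (nhds 0) := by
      refine squeeze_zero' (Eventually.of_forall fun q => by positivity) ?_ l3
      filter_upwards [l1.eventually_ge_atTop 1] with q hq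
      have := hTpos q.1 hq
      gcongr
      exact hTn q.1
    have hmq : Tendsto (fun q : ℕ × ℕ => m q.1) l atTop := hminf.comp l1
    have lim : Tendsto (fun q : ℕ × ℕ => ∑' j, G q.1 q.2 j) l
        (nhds (∑' j : ℕ, wco j * (1 + (j : ℝ)) ^ (-β₂))) := by
      refine tendsto_tsum_of_dominated_convergence
        (bound := fun j : ℕ => W ^ 2 * (1 + (j : ℝ)) ^ (-β₂))
        ((aux_summ β₂ hβ₂l).mul_left _) ?_ ?_
      · intro j
        have tX : Tendsto (fun q : ℕ × ℕ => X q.1 q.2 j) l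
            (nhds (wco j * (1 + (j : ℝ)) ^ (-β₂))) := by
          have a1 : Tendsto (fun q : ℕ × ℕ => w (q.2 + q.1) j) l (nhds (wco j)) :=
            (hA3 j).1.comp (tendsto_atTop_mono (fun q => Nat.le_add_left q.1 q.2) l1)
          have a2 : Tendsto (fun q : ℕ × ℕ => (1 + (q.2 : ℝ) + q.1) / q.1) l (nhds 1) := by
            have := l4.add_const 1
            rw [zero_add] at this
            refine this.congr' ?_
            filter_upwards [l1.eventually_ge_atTop 1] with q hq
            have : (0 : ℝ) < q.1 := by exact_mod_cast hq
            field_simp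
          have a3 := a2.rpow_const (p := -β₁) (Or.inl one_ne_zero)
          rw [Real.one_rpow] at a3
          have := (a1.mul a3).mul_const ((1 + (j : ℝ)) ^ (-β₂))
          rwa [mul_one] at this
        have tY : Tendsto (fun q : ℕ × ℕ => Y q.1 q.2 j) l (nhds 1) := by
          have a1 : Tendsto (fun q : ℕ × ℕ => w q.2 (j + m q.1)) l (nhds 1) :=
            by
            have a0 : Tendsto (fun q : ℕ × ℕ => j + m q.1) l atTop :=
              tendsto_atTop_mono (fun q => Nat.le_add_left (m q.1) j) hmq
            have a00 : Tendsto (fun q : ℕ × ℕ => (q.2, j + m q.1)) l (atTop ×ˢ atTop) :=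
              l2.prodMk a0
            exact Tendsto.comp (g := fun p : ℕ × ℕ => w p.1 p.2) hA1 a00
          have a2 : Tendsto (fun q : ℕ × ℕ => (1 + (j : ℝ) + m q.1) / m q.1) l (nhds 1) := by
            have hmR : Tendsto (fun q : ℕ × ℕ => (m q.1 : ℝ)) l atTop :=
              tendsto_natCast_atTop_atTop.comp hmq
            have := (hmR.const_div_atTop (1 + (j : ℝ))).add_const 1
            rw [zero_add] at this
            refine this.congr fun q => ?_
            have := hm0 q.1
            field_simp
          have a3 := a2.rpow_const (p := -β₂) (Or.inl one_ne_zero)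
          rw [Real.one_rpow] at a3
          have := a1.mul a3
          rwa [mul_one] at this
        have tr : Tendsto (fun q : ℕ × ℕ => r q.1 q.2) l (nhds 0) := by
          have := l3.rpow_const (p := β₁) (Or.inr hb0.le)
          rwa [Real.zero_rpow hb0.ne'] at this
        have tQ := (((tr.mul tX).pow 2).add (tY.pow 2)).rpow_const (p := -((2 - α) / 2))
          (Or.inl (by norm_num))
        have := (tX.mul tY).mul tQ
        simpa using this
      · filter_upwards [l1.eventually_ge_atTop 1] with q hq j
        have := hGle 0 le_rfl (by linarith) q.1 hq q.2 j
        simpa using this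
    intro ε hε
    have ev := lim.eventually (Metric.closedBall_mem_nhds _ hε)
    rw [hl, eventually_comap] at ev
    have hbas := (atTop_basis (α := ℕ)).prod ((atTop_basis (α := ℕ)).prod
      (Metric.nhds_basis_closedBall (x := (0 : ℝ))))
    obtain ⟨⟨N1, N2, η⟩, ⟨-, -, hη⟩, hsub⟩ := hbas.eventually_iff.1 ev
    simp only at hη
    obtain ⟨N3, hN3⟩ := eventually_atTop.1 (hT.eventually_ge_atTop (2 / η))
    refine ⟨η / 2, by positivity, N1 + N2 + N3 + 1, fun n hn i hi hiT => ?_⟩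
    have hTn0 := hTpos n (by omega)
    have hT2 := hN3 n (by omega)
    rw [div_le_iff₀ hη] at hT2
    have hsmall : (1 + (i : ℝ)) / T n ≤ η := by
      rw [div_le_iff₀ hTn0]; nlinarith
    have := hsub (x := Φ (n, i)) ?_ (n, i) rfl
    · rw [Real.dist_eq] at this
      simp only [hA]
      rw [tsum_mul_left, ← mul_assoc, mul_one_div_cancel (by positivity), one_mul]
      exact this
    · simp only [hΦ, mem_prod, mem_Ici, Metric.mem_closedBall, Real.dist_eq, sub_zero]
      refine ⟨by omega, by omega, ?_⟩
      rw [abs_of_nonneg (by positivity)]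
      exact hsmall
end
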